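/- arXiv:1409.1279 — 6 statements merged into one kernel-verified Lean document; each statement's English description precedes it below -/
import Mathlib

section
/- Let ψ̄ : ℝ^d → ℝ be differentiable and strictly convex, and define T(x) = ∇ψ̄(x). Then the straight-line trajectories of two distinct transported particles cannot collide: for all x₁ ≠ x₂ in ℝ^d and all t with 0 < t < 1, (1−t)x₁ + t·T(x₁) ≠ (1−t)x₂ + t·T(x₂). -/
/-- A strictly convex function lies strictly above its tangent hyperplanes. -/
theorem StrictConvexOn.fderiv_apply_sub_lt {E : Type*} [NormedAddCommGroup E] [NormedSpace ℝ E]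
    {f : E → ℝ} (hf : StrictConvexOn ℝ Set.univ f) {x y : E} (hdiff : DifferentiableAt ℝ f x)
    (hxy : x ≠ y) : fderiv ℝ f x (y - x) < f y - f x := by
  have hg : StrictConvexOn ℝ Set.univ (fun s : ℝ => f (AffineMap.lineMap x y s)) := by
    refine ⟨convex_univ, fun a _ b _ hab p q hp hq hpq => ?_⟩
    have h := hf.2 (Set.mem_univ (AffineMap.lineMap x y a))
      (Set.mem_univ (AffineMap.lineMap x y b))
      ((AffineMap.lineMap_injective ℝ hxy).ne hab) hp hq hpq
    rwa [← Convex.combo_affine_apply hpq] at h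
  have hd : HasDerivAt (fun s : ℝ => f (AffineMap.lineMap x y s)) (fderiv ℝ f x (y - x)) 0 := by
    refine HasFDerivAt.comp_hasDerivAt (0 : ℝ) ?_ AffineMap.hasDerivAt_lineMap
    simpa using hdiff.hasFDerivAt
  have h := hg.lt_slope_of_hasDerivAt (Set.mem_univ 0) (Set.mem_univ 1) zero_lt_one hd
  simpa [slope_def_field] using h

/-- The gradient of a differentiable strictly convex function is strictly monotone. -/
theorem StrictConvexOn.inner_sub_gradient_sub_pos {E : Type*} [NormedAddCommGroup E]
    [InnerProductSpace ℝ E] [CompleteSpace E] {f : E → ℝ} (hf : StrictConvexOn ℝ Set.univ f)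
    (hdiff : Differentiable ℝ f) {x y : E} (hxy : x ≠ y) :
    0 < inner ℝ (x - y) (gradient f x - gradient f y) := by
  have h₁ := hf.fderiv_apply_sub_lt (hdiff x) hxy
  have h₂ := hf.fderiv_apply_sub_lt (hdiff y) hxy.symm
  rw [← toDual_gradient, InnerProductSpace.toDual_apply_apply, real_inner_comm] at h₁ h₂
  rw [← neg_sub x y, inner_neg_left] at h₁
  rw [inner_sub_right]
  linarith

/-- If `T = ∇ψ̄` with `ψ̄` differentiable and strictly convex, then the straight-line
trajectories of two distinct transported particles cannot collide for `0 < t < 1`. -/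
theorem transported_particles_no_collision
    (d : ℕ) (ψbar : EuclideanSpace ℝ (Fin d) → ℝ)
    (hdiff : Differentiable ℝ ψbar)
    (hconv : StrictConvexOn ℝ Set.univ ψbar) :
    ∀ x₁ x₂ : EuclideanSpace ℝ (Fin d), x₁ ≠ x₂ → ∀ t : ℝ, 0 < t → t < 1 →
      (1 - t) • x₁ + t • gradient ψbar x₁ ≠ (1 - t) • x₂ + t • gradient ψbar x₂ := by
  intro x₁ x₂ hne t ht₀ ht₁ heq
  have hmono := hconv.inner_sub_gradient_sub_pos hdiff hne
  have hzero : (1 - t) • (x₁ - x₂) + t • (gradient ψbar x₁ - gradient ψbar x₂) = 0 := by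
    rw [smul_sub, smul_sub, sub_add_sub_comm, heq, sub_self]
  have hinner := congrArg (inner ℝ (x₁ - x₂)) hzero
  rw [inner_add_right, real_inner_smul_right, real_inner_smul_right, inner_zero_right] at hinner
  have hself : 0 ≤ inner ℝ (x₁ - x₂) (x₁ - x₂) := real_inner_self_nonneg
  have := mul_nonneg (sub_nonneg.2 ht₁.le) hself
  have := mul_pos ht₀ hmono
  linarith
end

section
/- Let c(x,y) = ½‖x − y‖² on ℝ^d × ℝ^d and let ψ : ℝ^d → ℝ be such that for every y the function x ↦ ½‖x − y‖² − ψ(x) is bounded below; define ψᶜ(y) = inf_{x ∈ ℝ^d} (½‖x − y‖² − ψ(x)). Suppose ψᶜ(y) + ψ(x) = ½‖x − y‖² and ψ is differentiable at x. Then y = x − ∇ψ(x); in particular every point y assigned to x by the c-subdifferential is uniquely determined by T(x) = x − ∇ψ(x). -/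
/-- The gradient of `x ↦ ½‖x − y‖²` is `x − y`. -/
theorem hasGradientAt_half_norm_sub_sq {E : Type*} [NormedAddCommGroup E]
    [InnerProductSpace ℝ E] [CompleteSpace E] (x y : E) :
    HasGradientAt (fun z => (1 / 2 : ℝ) * ‖z - y‖ ^ 2) (x - y) x := by
  rw [hasGradientAt_iff_hasFDerivAt]
  refine (((hasFDerivAt_id x).sub_const y).norm_sq.const_mul (1 / 2 : ℝ)).congr_fderiv ?_
  ext v
  simp

/-- For the quadratic cost `c(x,y) = ½‖x−y‖²`, if `(x,y)` lies in the c-subdifferential of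
`ψ` and `ψ` is differentiable at `x`, then `y = x − ∇ψ(x)`. -/
theorem c_subdifferential_quadratic_transport
    (d : ℕ) (ψ : EuclideanSpace ℝ (Fin d) → ℝ)
    (hbdd : ∀ y : EuclideanSpace ℝ (Fin d),
      BddBelow (Set.range fun x => (1 / 2) * ‖x - y‖ ^ 2 - ψ x))
    (x y : EuclideanSpace ℝ (Fin d))
    (hsub : (⨅ x' : EuclideanSpace ℝ (Fin d), ((1 / 2) * ‖x' - y‖ ^ 2 - ψ x')) + ψ x
      = (1 / 2) * ‖x - y‖ ^ 2)
    (hψ : DifferentiableAt ℝ ψ x) :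
    y = x - gradient ψ x := by
  have hmin : IsMinOn (fun z => (1 / 2) * ‖z - y‖ ^ 2 - ψ z) Set.univ x := fun z _ => by
    have hz := ciInf_le (hbdd y) z
    change _ - ψ x ≤ _ - ψ z
    linarith
  have hgrad := (hasGradientAt_half_norm_sub_sq x y).hasFDerivAt.sub
    hψ.hasGradientAt.hasFDerivAt
  have hzero := (hmin.isLocalMin Filter.univ_mem).hasFDerivAt_eq_zero hgrad
  rw [← map_sub, LinearIsometryEquiv.map_eq_zero_iff] at hzero
  rw [← sub_eq_zero.mp hzero, sub_sub_cancel]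
end

section
/- Let μ be a finite measure on ℝ^d with ∫‖x‖² dμ(x) < ∞, let y₁, …, y_k ∈ ℝ^d, and let W = (w₁,…,w_k) ∈ ℝ^k. Let T : ℝ^d → Fin k be a measurable assignment such that for μ-almost every x, ‖x − y_{T(x)}‖² − w_{T(x)} = min_{1≤j≤k} (‖x − y_j‖² − w_j) (i.e., T assigns each point to a power cell containing it). Then for every measurable assignment S : ℝ^d → Fin k with μ(S⁻¹{i}) = μ(T⁻¹{i}) for all i, one has ∫ ‖x − y_{T(x)}‖² dμ(x) ≤ ∫ ‖x − y_{S(x)}‖² dμ(x). In other words, the assignment defined by the power diagram is optimal among all assignments transporting μ to the same discrete measure. -/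
open MeasureTheory

theorem integrable_norm_sub_sq_comp_of_finite {E ι : Type*} [NormedAddCommGroup E]
    [MeasurableSpace E] [OpensMeasurableSpace E] [SecondCountableTopology E]
    [Fintype ι] [MeasurableSpace ι] [DiscreteMeasurableSpace ι]
    {μ : Measure E} [IsFiniteMeasure μ] (hint : Integrable (fun x => ‖x‖ ^ 2) μ)
    (y : ι → E) {S : E → ι} (hS : Measurable S) :
    Integrable (fun x => ‖x - y (S x)‖ ^ 2) μ := by
  have hy : StronglyMeasurable y := .of_discrete
  refine ((hint.const_mul 2).add (integrable_const (2 * ∑ i, ‖y i‖ ^ 2))).mono'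
    ((stronglyMeasurable_id.sub (hy.comp_measurable hS)).norm.pow 2).aestronglyMeasurable
    (.of_forall fun x => ?_)
  have hsum : ‖y (S x)‖ ^ 2 ≤ ∑ i, ‖y i‖ ^ 2 :=
    Finset.single_le_sum (f := fun i => ‖y i‖ ^ 2) (fun i _ => sq_nonneg _) (Finset.mem_univ _)
  have hsub : ‖x - y (S x)‖ ^ 2 ≤ (‖x‖ + ‖y (S x)‖) ^ 2 := by
    gcongr
    exact norm_sub_le _ _
  simp only [norm_pow, norm_norm, Pi.add_apply]
  nlinarith [sq_nonneg (‖x‖ - ‖y (S x)‖)]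

theorem integral_comp_eq_of_measure_fiber_eq {α ι : Type*} [MeasurableSpace α]
    [Countable ι] [MeasurableSpace ι] [DiscreteMeasurableSpace ι]
    {μ : Measure α} {S T : α → ι} (hS : Measurable S) (hT : Measurable T)
    (h : ∀ i, μ (S ⁻¹' {i}) = μ (T ⁻¹' {i})) (w : ι → ℝ) :
    ∫ x, w (S x) ∂μ = ∫ x, w (T x) ∂μ := by
  have hmap : μ.map S = μ.map T := by
    refine Measure.ext_of_singleton fun i => ?_
    rw [Measure.map_apply hS (measurableSet_singleton i),
      Measure.map_apply hT (measurableSet_singleton i), h i]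
  have hw : StronglyMeasurable w := .of_discrete
  rw [← integral_map hS.aemeasurable hw.aestronglyMeasurable, hmap,
    integral_map hT.aemeasurable hw.aestronglyMeasurable]

/-- The assignment defined by a power diagram is optimal among all measurable
assignments transporting `μ` to the same discrete measure. -/
theorem power_diagram_assignment_optimal
    (d k : ℕ) (μ : Measure (EuclideanSpace ℝ (Fin d))) [IsFiniteMeasure μ]
    (hint : Integrable (fun x => ‖x‖ ^ 2) μ)
    (y : Fin k → EuclideanSpace ℝ (Fin d)) (w : Fin k → ℝ)
    (T : EuclideanSpace ℝ (Fin d) → Fin k) (hT : Measurable T)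
    (hTopt : ∀ᵐ x ∂μ,
      ‖x - y (T x)‖ ^ 2 - w (T x) = ⨅ j : Fin k, (‖x - y j‖ ^ 2 - w j)) :
    ∀ S : EuclideanSpace ℝ (Fin d) → Fin k, Measurable S →
      (∀ i : Fin k, μ (S ⁻¹' {i}) = μ (T ⁻¹' {i})) →
      ∫ x, ‖x - y (T x)‖ ^ 2 ∂μ ≤ ∫ x, ‖x - y (S x)‖ ^ 2 ∂μ := by
  intro S hS hfiber
  have hcost {R : EuclideanSpace ℝ (Fin d) → Fin k} (hR : Measurable R) :
      Integrable (fun x => ‖x - y (R x)‖ ^ 2) μ :=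
    integrable_norm_sub_sq_comp_of_finite hint y hR
  have hweight {R : EuclideanSpace ℝ (Fin d) → Fin k} (hR : Measurable R) :
      Integrable (fun x => w (R x)) μ :=
    Integrable.comp_measurable (g := w) .of_finite hR
  have hle : ∫ x, (‖x - y (T x)‖ ^ 2 - w (T x)) ∂μ ≤
      ∫ x, (‖x - y (S x)‖ ^ 2 - w (S x)) ∂μ := by
    refine integral_mono_ae ((hcost hT).sub (hweight hT)) ((hcost hS).sub (hweight hS)) ?_
    filter_upwards [hTopt] with x hx
    exact hx.trans_le (ciInf_le (Set.finite_range _).bddBelow (S x))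
  rw [integral_sub (hcost hT) (hweight hT), integral_sub (hcost hS) (hweight hS),
    integral_comp_eq_of_measure_fiber_eq hS hT hfiber w] at hle
  linarith
end

section
/- Let μ be a finite measure on ℝ^d with ∫‖x‖² dμ(x) < ∞, let p₁, …, p_k ∈ ℝ^d, and let ν₁, …, ν_k ∈ ℝ. Then the function g : ℝ^k → ℝ defined by g(W) = F(W) + Σ_{i=1}^k ν_i w_i, where F(W) = ∫ min_{1≤i≤k} (‖x − p_i‖² − w_i) dμ(x), is concave on ℝ^k. -/
open MeasureTheory

theorem integrable_ciInf {α ι : Type*} [Fintype ι] [Nonempty ι] [MeasurableSpace α]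
    {μ : Measure α} {f : ι → α → ℝ} (hf : ∀ i, Integrable (f i) μ) :
    Integrable (fun x => ⨅ i, f i x) μ := by
  have h : Integrable (Finset.univ.inf' Finset.univ_nonempty f) μ :=
    Finset.inf'_induction (p := fun g => Integrable g μ) _ _
      (fun _ h₁ _ h₂ => h₁.inf h₂) fun i _ => hf i
  refine h.congr (Filter.Eventually.of_forall fun x => ?_)
  simp only [Finset.inf'_apply, Finset.inf'_univ_eq_ciInf]

theorem integrable_norm_sub_const_sq {E : Type*} [NormedAddCommGroup E] [MeasurableSpace E]
    [OpensMeasurableSpace E] [SecondCountableTopology E] {μ : Measure E} [IsFiniteMeasure μ]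
    (h : Integrable (fun x => ‖x‖ ^ 2) μ) (a : E) :
    Integrable (fun x => ‖x - a‖ ^ 2) μ := by
  have hid : MemLp (fun x : E => x) 2 μ :=
    (memLp_two_iff_integrable_sq_norm continuous_id.aestronglyMeasurable).2 h
  have hsub : MemLp (fun x : E => x - a) 2 μ := hid.sub (memLp_const a)
  exact (memLp_two_iff_integrable_sq_norm hsub.1).1 hsub

theorem concaveOn_ciInf_sub {ι : Type*} [Finite ι] [Nonempty ι] (c : ι → ℝ) :
    ConcaveOn ℝ Set.univ (fun W : ι → ℝ => ⨅ i, (c i - W i)) := by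
  refine ⟨convex_univ, fun V _ W _ a b ha hb hab => le_ciInf fun i => ?_⟩
  have hV : ⨅ i, (c i - V i) ≤ c i - V i := ciInf_le (Set.finite_range _).bddBelow i
  have hW : ⨅ i, (c i - W i) ≤ c i - W i := ciInf_le (Set.finite_range _).bddBelow i
  calc a • (⨅ i, (c i - V i)) + b • (⨅ i, (c i - W i))
      ≤ a * (c i - V i) + b * (c i - W i) := by
        simp only [smul_eq_mul]
        gcongr
    _ = c i - (a • V + b • W) i := by
        simp only [Pi.add_apply, Pi.smul_apply, smul_eq_mul]
        linear_combination c i * hab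

theorem concaveOn_integral {α E : Type*} [AddCommGroup E] [Module ℝ E] [MeasurableSpace α]
    {μ : Measure α} {s : Set E} {f : E → α → ℝ} (hs : Convex ℝ s)
    (hint : ∀ W ∈ s, Integrable (f W) μ) (hf : ∀ x, ConcaveOn ℝ s (fun W => f W x)) :
    ConcaveOn ℝ s (fun W => ∫ x, f W x ∂μ) := by
  refine ⟨hs, fun V hV W hW a b ha hb hab => ?_⟩
  have hVa := (hint V hV).smul a
  have hWb := (hint W hW).smul b
  calc a • (∫ x, f V x ∂μ) + b • (∫ x, f W x ∂μ)
      = ∫ x, (a • f V x + b • f W x) ∂μ := by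
        rw [← integral_smul, ← integral_smul]
        exact (integral_add hVa hWb).symm
    _ ≤ ∫ x, f (a • V + b • W) x ∂μ :=
        integral_mono (hVa.add hWb) (hint _ (hs hV hW ha hb hab))
          fun x => (hf x).2 hV hW ha hb hab

/-- The function `g(W) = ∫ min_i (‖x − p_i‖² − w_i) dμ(x) + Σ_i ν_i w_i` is concave. -/
theorem semi_discrete_objective_concave
    (d k : ℕ) (μ : Measure (EuclideanSpace ℝ (Fin d))) [IsFiniteMeasure μ]
    (hint : Integrable (fun x => ‖x‖ ^ 2) μ)
    (p : Fin k → EuclideanSpace ℝ (Fin d)) (ν : Fin k → ℝ) :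
    ConcaveOn ℝ Set.univ
      (fun W : Fin k → ℝ =>
        (∫ x, (⨅ i : Fin k, (‖x - p i‖ ^ 2 - W i)) ∂μ) + ∑ i : Fin k, ν i * W i) := by
  refine ConcaveOn.add ?_ ?_
  · rcases isEmpty_or_nonempty (Fin k) with hk | hk
    · simpa only [Real.iInf_of_isEmpty] using concaveOn_const _ convex_univ
    · exact concaveOn_integral convex_univ
        (fun W _ => integrable_ciInf fun i =>
          (integrable_norm_sub_const_sq hint (p i)).sub (integrable_const (W i)))
        fun x => concaveOn_ciInf_sub fun i => ‖x - p i‖ ^ 2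
  · exact (Fintype.linearCombination ℝ ν).concaveOn convex_univ |>.congr fun W _ => by
      simp [Fintype.linearCombination_apply, mul_comm]
end

section
/- Let μ be a finite measure on ℝ^d that is absolutely continuous with respect to Lebesgue measure and satisfies ∫‖x‖² dμ(x) < ∞, and let p₁, …, p_k ∈ ℝ^d be pairwise distinct. Then the function F(W) = ∫ min_{1≤i≤k} (‖x − p_i‖² − w_i) dμ(x) is differentiable at every W ∈ ℝ^k, with partial derivatives ∂F/∂w_i (W) = −μ(Pow_W(p_i)). -/
open MeasureTheory

/-- The power cell of `p i` for the weight vector `W`. -/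
def powerCell {d k : ℕ} (p : Fin k → EuclideanSpace ℝ (Fin d)) (W : Fin k → ℝ)
    (i : Fin k) : Set (EuclideanSpace ℝ (Fin d)) :=
  {x | ∀ j : Fin k, j ≠ i → ‖x - p i‖ ^ 2 - W i < ‖x - p j‖ ^ 2 - W j}

/-- Affine hyperplanes are null for Lebesgue measure. -/
lemma volume_inner_eq_const {E : Type*} [NormedAddCommGroup E] [InnerProductSpace ℝ E]
    [FiniteDimensional ℝ E] [MeasurableSpace E] [BorelSpace E] {v : E} (hv : v ≠ 0) (c : ℝ) :
    volume {x : E | inner ℝ v x = c} = 0 := by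
  let s : AffineSubspace ℝ E :=
    { carrier := {x | inner ℝ v x = c}
      smul_vsub_vadd_mem' := by
        intro t x y z hx hy hz
        simp only [Set.mem_ofPred_eq] at hx hy hz
        simp [inner_add_right, inner_sub_right, real_inner_smul_right, hx, hy, hz] }
  refine Measure.addHaar_affineSubspace volume s fun hs => hv ?_
  have mem (x : E) : inner ℝ v x = c := by
    have : x ∈ s := hs ▸ AffineSubspace.mem_top ℝ E x
    exact this
  rw [← inner_self_eq_zero (𝕜 := ℝ), mem v, ← mem 0, inner_zero_right]

/-- The bisector of two distinct weighted points is null for Lebesgue measure. -/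
lemma volume_power_bisector {E : Type*} [NormedAddCommGroup E] [InnerProductSpace ℝ E]
    [FiniteDimensional ℝ E] [MeasurableSpace E] [BorelSpace E] {p q : E} (hpq : p ≠ q)
    (a b : ℝ) : volume {x : E | ‖x - p‖ ^ 2 - a = ‖x - q‖ ^ 2 - b} = 0 := by
  refine measure_mono_null (fun x hx => ?_)
    (volume_inner_eq_const (sub_ne_zero.2 hpq) ((‖p‖ ^ 2 - a - ‖q‖ ^ 2 + b) / 2))
  simp only [Set.mem_ofPred_eq, norm_sub_sq_real] at hx ⊢
  rw [inner_sub_left, real_inner_comm, real_inner_comm x q]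
  linarith

lemma abs_iInf_sub_iInf_le {ι : Type*} [Finite ι] [Nonempty ι] {f g : ι → ℝ} {C : ℝ}
    (h : ∀ i, |f i - g i| ≤ C) : |(⨅ i, f i) - ⨅ i, g i| ≤ C := by
  have key {f g : ι → ℝ} (h : ∀ i, f i - g i ≤ C) : (⨅ i, f i) - C ≤ ⨅ i, g i :=
    le_ciInf fun i => by
      linarith [ciInf_le (Set.finite_range f).bddBelow i, h i]
  rw [abs_le]
  have h₁ := key fun i => (abs_le.1 (h i)).2
  have h₂ := key (f := g) (g := f) fun i => by linarith [(abs_le.1 (h i)).1]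
  constructor <;> linarith

lemma integrable_iInf {α ι : Type*} [MeasurableSpace α] {μ : Measure α} [Fintype ι]
    [Nonempty ι] {f : ι → α → ℝ} (hm : ∀ i, Measurable (f i)) (hf : ∀ i, Integrable (f i) μ) :
    Integrable (fun x => ⨅ i, f i x) μ := by
  refine (integrable_finsetSum Finset.univ fun i _ => (hf i).norm).mono'
    (Measurable.iInf hm).aestronglyMeasurable (ae_of_all _ fun x => ?_)
  obtain ⟨i, hi⟩ := exists_eq_ciInf_of_finite (f := fun i => f i x)
  rw [← hi]
  exact Finset.single_le_sum (f := fun i => ‖f i x‖) (fun _ _ => norm_nonneg _)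
    (Finset.mem_univ i)

lemma integrable_norm_sub_sq {E : Type*} [NormedAddCommGroup E] [MeasurableSpace E]
    [BorelSpace E] [SecondCountableTopology E] {μ : Measure E} [IsFiniteMeasure μ]
    (hint : Integrable (fun x => ‖x‖ ^ 2) μ) (q : E) :
    Integrable (fun x => ‖x - q‖ ^ 2) μ := by
  have h : MemLp (fun x : E => x) 2 μ :=
    (memLp_two_iff_integrable_sq_norm aestronglyMeasurable_id).2 hint
  have h' := h.sub (memLp_const q)
  exact (memLp_two_iff_integrable_sq_norm h'.1).1 h'

lemma measurableSet_powerCell {d k : ℕ} (p : Fin k → EuclideanSpace ℝ (Fin d))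
    (W : Fin k → ℝ) (i : Fin k) : MeasurableSet (powerCell p W i) := by
  have : powerCell p W i = ⋂ j : Fin k, ⋂ _ : j ≠ i,
      {x | ‖x - p i‖ ^ 2 - W i < ‖x - p j‖ ^ 2 - W j} := by
    ext x; simp [powerCell]
  rw [this]
  exact MeasurableSet.iInter fun j => MeasurableSet.iInter fun _ =>
    measurableSet_lt (by fun_prop) (by fun_prop)

lemma notMem_powerCell_of_mem {d k : ℕ} {p : Fin k → EuclideanSpace ℝ (Fin d)}
    {W : Fin k → ℝ} {i j : Fin k} {x : EuclideanSpace ℝ (Fin d)} (hx : x ∈ powerCell p W i)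
    (hij : j ≠ i) : x ∉ powerCell p W j :=
  fun hj => lt_asymm (hx j hij) (hj i hij.symm)

/-- Almost every point lies in some power cell. -/
lemma ae_exists_mem_powerCell {d k : ℕ} [Nonempty (Fin k)]
    {p : Fin k → EuclideanSpace ℝ (Fin d)} (hp : Function.Injective p) (W : Fin k → ℝ) :
    ∀ᵐ x, ∃ i, x ∈ powerCell p W i := by
  have h : ∀ᵐ x, ∀ i j : Fin k, j ≠ i → ‖x - p i‖ ^ 2 - W i ≠ ‖x - p j‖ ^ 2 - W j := by
    simp only [ae_all_iff]
    intro i j hij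
    rw [ae_iff]
    simpa using volume_power_bisector (hp.ne hij.symm) (W i) (W j)
  filter_upwards [h] with x hx
  obtain ⟨i, hi⟩ := Finite.exists_min fun i => ‖x - p i‖ ^ 2 - W i
  exact ⟨i, fun j hj => lt_of_le_of_ne (hi j) (hx i j hj)⟩

/-- On the power cell of `p i`, the minimum is given by the index `i` for all weights near `W`. -/
lemma hasFDerivAt_iInf_of_mem_powerCell {d k : ℕ} {p : Fin k → EuclideanSpace ℝ (Fin d)}
    {W : Fin k → ℝ} {i : Fin k} {x : EuclideanSpace ℝ (Fin d)} (hx : x ∈ powerCell p W i) :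
    HasFDerivAt (fun W' : Fin k → ℝ => ⨅ j, (‖x - p j‖ ^ 2 - W' j))
      (-(ContinuousLinearMap.proj i : (Fin k → ℝ) →L[ℝ] ℝ)) W := by
  have hd : HasFDerivAt (fun W' : Fin k → ℝ => ‖x - p i‖ ^ 2 - W' i)
      (-(ContinuousLinearMap.proj i : (Fin k → ℝ) →L[ℝ] ℝ)) W :=
    (hasFDerivAt_apply i W).const_sub _
  refine hd.congr_of_eventuallyEq ?_
  have hev : ∀ᶠ W' : Fin k → ℝ in nhds W, ∀ j, j ≠ i →
      ‖x - p i‖ ^ 2 - W' i < ‖x - p j‖ ^ 2 - W' j := by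
    simp only [Filter.eventually_all]
    intro j hj
    have hc (l : Fin k) : Continuous fun W' : Fin k → ℝ => ‖x - p l‖ ^ 2 - W' l := by fun_prop
    exact (hc i).continuousAt.eventually_lt (hc j).continuousAt (hx j hj)
  filter_upwards [hev] with W' hW'
  have : Nonempty (Fin k) := ⟨i⟩
  refine le_antisymm (ciInf_le (Set.finite_range _).bddBelow i) (le_ciInf fun j => ?_)
  rcases eq_or_ne j i with rfl | hj
  · exact le_rfl
  · exact (hW' j hj).le

/-- `F(W) = ∫ min_i (‖x − p_i‖² − w_i) dμ` is differentiable everywhere, with partial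
derivatives `∂F/∂w_i (W) = −μ(Pow_W(p_i))`. -/
theorem transport_objective_differentiable
    (d k : ℕ) (μ : Measure (EuclideanSpace ℝ (Fin d))) [IsFiniteMeasure μ]
    (hac : μ ≪ volume) (hint : Integrable (fun x => ‖x‖ ^ 2) μ)
    (p : Fin k → EuclideanSpace ℝ (Fin d)) (hp : Function.Injective p) :
    ∀ W : Fin k → ℝ,
      HasFDerivAt (fun W' : Fin k → ℝ => ∫ x, (⨅ i : Fin k, (‖x - p i‖ ^ 2 - W' i)) ∂μ)
        (∑ i : Fin k, (-(μ (powerCell p W i)).toReal) •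
          (ContinuousLinearMap.proj i : (Fin k → ℝ) →L[ℝ] ℝ)) W := by
  intro W
  rcases isEmpty_or_nonempty (Fin k) with hk | hk
  · exact (hasFDerivAt_of_subsingleton _ W).congr_fderiv (by simp)
  let F' : EuclideanSpace ℝ (Fin d) → (Fin k → ℝ) →L[ℝ] ℝ := fun x =>
    ∑ i, (powerCell p W i).indicator (fun _ => -(ContinuousLinearMap.proj i)) x
  have hF' : Measurable F' := Finset.measurable_fun_sum _ fun i _ =>
    measurable_const.indicator (measurableSet_powerCell p W i)
  have hmeas (V : Fin k → ℝ) (i : Fin k) :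
      Measurable fun x : EuclideanSpace ℝ (Fin d) => ‖x - p i‖ ^ 2 - V i := by fun_prop
  have hintegral : ∫ x, F' x ∂μ = ∑ i : Fin k, (-(μ (powerCell p W i)).toReal) •
      (ContinuousLinearMap.proj i : (Fin k → ℝ) →L[ℝ] ℝ) := by
    rw [integral_finsetSum _ fun i _ =>
      (integrable_const _).indicator (measurableSet_powerCell p W i)]
    refine Finset.sum_congr rfl fun i _ => ?_
    rw [integral_indicator_const _ (measurableSet_powerCell p W i), smul_neg]
    exact (neg_smul _ _).symm
  rw [← hintegral]
  refine (hasFDerivAt_integral_of_dominated_loc_of_lip' (bound := fun _ => 1) Filter.univ_mem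
    (fun V _ => (Measurable.iInf (hmeas V)).aestronglyMeasurable)
    (integrable_iInf (hmeas W) fun i =>
      (integrable_norm_sub_sq hint (p i)).sub (integrable_const _))
    hF'.aestronglyMeasurable (ae_of_all _ fun x V _ => ?_) (integrable_const _) ?_).2
  · rw [one_mul, Real.norm_eq_abs]
    refine abs_iInf_sub_iInf_le fun i => ?_
    rw [sub_sub_sub_cancel_left, abs_sub_comm]
    exact norm_le_pi_norm (V - W) i
  · filter_upwards [hac.ae_le (ae_exists_mem_powerCell hp W)] with x ⟨i, hi⟩
    refine (hasFDerivAt_iInf_of_mem_powerCell hi).congr_fderiv ?_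
    rw [show F' x = _ from Finset.sum_eq_single i (fun j _ hj =>
      Set.indicator_of_notMem (notMem_powerCell_of_mem hi hj) _) (by simp),
      Set.indicator_of_mem hi]
end

section
/- Let μ be a finite measure on ℝ^d that is absolutely continuous with respect to Lebesgue measure and satisfies ∫‖x‖² dμ(x) < ∞, and let Y = (y₁,…,y_k) ∈ (ℝ^d)^k have pairwise distinct points. If Y is a stationary point of the quantization noise power Q (i.e., the gradient of Q vanishes at Y) and μ(Vor(y_i)) > 0 for some i, then y_i equals the centroid of its Voronoi cell: y_i = (1/μ(Vor(y_i))) ∫_{Vor(y_i)} x dμ(x). In other words, stationary point configurations of Q are centroidal Voronoi tessellations. -/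
open MeasureTheory

/-- The Voronoi cell of `Y i`. -/
def voronoiCell {d k : ℕ} (Y : Fin k → EuclideanSpace ℝ (Fin d)) (i : Fin k) :
    Set (EuclideanSpace ℝ (Fin d)) :=
  {x | ∀ j : Fin k, j ≠ i → ‖x - Y i‖ ^ 2 < ‖x - Y j‖ ^ 2}

/-- Almost every point lies in a Voronoi cell. -/
theorem ae_exists_mem_voronoiCell {d k : ℕ} [NeZero k] {μ : Measure (EuclideanSpace ℝ (Fin d))}
    (hac : μ ≪ volume) {Y : Fin k → EuclideanSpace ℝ (Fin d)} (hY : Function.Injective Y) :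
    ∀ᵐ x ∂μ, ∃ i, x ∈ voronoiCell Y i := by
  have h : ∀ᵐ x ∂μ, ∀ i j : Fin k, i ≠ j → ‖x - Y i‖ ≠ ‖x - Y j‖ := by
    refine ae_all_iff.2 fun i => ae_all_iff.2 fun j => ?_
    by_cases hij : i = j
    · simp [hij]
    have h0 : volume (AffineSubspace.perpBisector (Y i) (Y j) :
        Set (EuclideanSpace ℝ (Fin d))) = 0 := by
      apply Measure.addHaar_affineSubspace
      simpa using fun h => hij (hY h)
    filter_upwards [measure_eq_zero_iff_ae_notMem.1 (hac h0)] with x hx _ h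
    apply hx
    rw [SetLike.mem_coe, AffineSubspace.mem_perpBisector_iff_dist_eq, dist_eq_norm, dist_eq_norm, h]
  filter_upwards [h] with x hx
  obtain ⟨i, hi⟩ := Finite.exists_min (fun i => ‖x - Y i‖)
  refine ⟨i, fun j hj => ?_⟩
  exact pow_lt_pow_left₀ (lt_of_le_of_ne (hi j) (hx i j hj.symm)) (norm_nonneg _) two_ne_zero

theorem isOpen_voronoiCell {d k : ℕ} (Y : Fin k → EuclideanSpace ℝ (Fin d)) (i : Fin k) :
    IsOpen (voronoiCell Y i) := by
  simp only [voronoiCell, Set.ofPred_forall]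
  refine isOpen_iInter_of_finite fun j => isOpen_iInter_of_finite fun _ => ?_
  exact isOpen_lt (by fun_prop) (by fun_prop)

theorem disjoint_voronoiCell {d k : ℕ} {Y : Fin k → EuclideanSpace ℝ (Fin d)} {i j : Fin k}
    {x : EuclideanSpace ℝ (Fin d)} (hi : x ∈ voronoiCell Y i) (hj : x ∈ voronoiCell Y j) :
    i = j := by
  by_contra h
  exact lt_asymm (hi j (Ne.symm h)) (hj i h)

/-- The squared distance to the nearest site is Lipschitz in the sites, locally. -/
theorem lipschitzOnWith_iInf_norm_sub_sq {d k : ℕ} [NeZero k]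
    (Y : Fin k → EuclideanSpace ℝ (Fin d)) (x : EuclideanSpace ℝ (Fin d)) :
    LipschitzOnWith (Real.nnabs (2 * (‖x‖ + ‖Y‖ + 1)))
      (fun Z : Fin k → EuclideanSpace ℝ (Fin d) => ⨅ i : Fin k, ‖x - Z i‖ ^ 2)
      (Metric.ball Y 1) := by
  have hb : ∀ Z ∈ Metric.ball Y 1, ∀ i, ‖x - Z i‖ ≤ ‖x‖ + ‖Y‖ + 1 := by
    intro Z hZ i
    have h1 : ‖Z i - Y i‖ ≤ 1 := by
      rw [mem_ball_iff_norm] at hZ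
      exact (norm_le_pi_norm (Z - Y) i).trans hZ.le
    have h2 := norm_le_pi_norm Y i
    have h3 : x - Z i = x - Y i - (Z i - Y i) := by abel
    have h4 := norm_sub_le (x - Y i) (Z i - Y i)
    have h5 := norm_sub_le x (Y i)
    rw [h3]
    linarith
  refine LipschitzOnWith.of_le_add_mul _ fun Z hZ W hW => ?_
  obtain ⟨i, hi⟩ := exists_eq_ciInf_of_finite (f := fun i => ‖x - W i‖ ^ 2)
  rw [← hi, Real.coe_nnabs, abs_of_nonneg (by positivity)]
  refine (ciInf_le (Set.finite_range _).bddBelow i).trans ?_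
  have h1 := hb Z hZ i
  have h2 := hb W hW i
  have h3 : ‖x - Z i‖ ≤ ‖x - W i‖ + dist Z W := by
    have h4 : x - Z i = x - W i - (Z i - W i) := by abel
    have h5 : ‖Z i - W i‖ ≤ dist Z W := by
      rw [dist_eq_norm]
      exact norm_le_pi_norm (Z - W) i
    have h6 := norm_sub_le (x - W i) (Z i - W i)
    rw [h4]
    linarith
  have h7 : (‖x - Z i‖ - ‖x - W i‖) * (‖x - Z i‖ + ‖x - W i‖)
      ≤ dist Z W * (2 * (‖x‖ + ‖Y‖ + 1)) :=
    mul_le_mul (by linarith) (by linarith) (by positivity) dist_nonneg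
  linarith

/-- On the Voronoi cell of `Y i`, the squared distance to the nearest site is differentiable
in the sites, and its derivative only involves the `i`-th site. -/
theorem hasFDerivAt_iInf_norm_sub_sq {d k : ℕ} {Y : Fin k → EuclideanSpace ℝ (Fin d)}
    {x : EuclideanSpace ℝ (Fin d)} {i : Fin k} (hx : x ∈ voronoiCell Y i) :
    HasFDerivAt (fun Z : Fin k → EuclideanSpace ℝ (Fin d) => ⨅ i : Fin k, ‖x - Z i‖ ^ 2)
      ((innerSL ℝ ((-2 : ℝ) • (x - Y i))).comp
        (ContinuousLinearMap.proj (R := ℝ) (φ := fun _ : Fin k => EuclideanSpace ℝ (Fin d)) i))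
      Y := by
  have h : HasFDerivAt (fun Z : Fin k → EuclideanSpace ℝ (Fin d) => ‖x - Z i‖ ^ 2)
      ((innerSL ℝ ((-2 : ℝ) • (x - Y i))).comp
        (ContinuousLinearMap.proj (R := ℝ) (φ := fun _ : Fin k => EuclideanSpace ℝ (Fin d)) i))
      Y := by
    refine (((ContinuousLinearMap.proj (R := ℝ)
      (φ := fun _ : Fin k => EuclideanSpace ℝ (Fin d)) i).hasFDerivAt (x := Y)).const_sub
        x).norm_sq.congr_fderiv ?_
    ext1 v
    simp
    ring
  refine h.congr_of_eventuallyEq ?_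
  have hev : ∀ᶠ Z in nhds Y, ∀ j, j ≠ i → ‖x - Z i‖ ^ 2 < ‖x - Z j‖ ^ 2 := by
    refine Filter.eventually_all.2 fun j => ?_
    by_cases hj : j = i
    · simp [hj]
    have hc : IsOpen {Z : Fin k → EuclideanSpace ℝ (Fin d) | ‖x - Z i‖ ^ 2 < ‖x - Z j‖ ^ 2} :=
      isOpen_lt (by fun_prop) (by fun_prop)
    filter_upwards [hc.mem_nhds (hx j hj)] with Z hZ _ using hZ
  filter_upwards [hev] with Z hZ
  have : Nonempty (Fin k) := ⟨i⟩
  refine le_antisymm (ciInf_le (Set.finite_range _).bddBelow i) (le_ciInf fun j => ?_)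
  by_cases hj : j = i
  · rw [hj]
  · exact (hZ j hj).le

/-- The derivative in the sites of the squared distance to the nearest site, off the cell
boundaries. -/
noncomputable def quantizationDeriv {d k : ℕ} (Y : Fin k → EuclideanSpace ℝ (Fin d))
    (x : EuclideanSpace ℝ (Fin d)) : (Fin k → EuclideanSpace ℝ (Fin d)) →L[ℝ] ℝ :=
  ∑ i, (voronoiCell Y i).indicator (fun x => (innerSL ℝ ((-2 : ℝ) • (x - Y i))).comp
    (ContinuousLinearMap.proj (R := ℝ) (φ := fun _ : Fin k => EuclideanSpace ℝ (Fin d)) i)) x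

theorem quantizationDeriv_of_mem {d k : ℕ} {Y : Fin k → EuclideanSpace ℝ (Fin d)}
    {x : EuclideanSpace ℝ (Fin d)} {i : Fin k} (hx : x ∈ voronoiCell Y i) :
    quantizationDeriv Y x = (innerSL ℝ ((-2 : ℝ) • (x - Y i))).comp
      (ContinuousLinearMap.proj (R := ℝ) (φ := fun _ : Fin k => EuclideanSpace ℝ (Fin d)) i) := by
  rw [quantizationDeriv, Finset.sum_eq_single i, Set.indicator_of_mem hx]
  · exact fun j _ hj => Set.indicator_of_notMem (fun h => hj (disjoint_voronoiCell h hx)) _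
  · simp

theorem stronglyMeasurable_quantizationDeriv {d k : ℕ} (Y : Fin k → EuclideanSpace ℝ (Fin d)) :
    StronglyMeasurable (quantizationDeriv Y) := by
  unfold quantizationDeriv
  refine Finset.stronglyMeasurable_fun_sum _ fun i _ => ?_
  refine StronglyMeasurable.indicator (Continuous.stronglyMeasurable ?_)
    (isOpen_voronoiCell Y i).measurableSet
  fun_prop

theorem quantizationDeriv_single {d k : ℕ} (Y : Fin k → EuclideanSpace ℝ (Fin d))
    (x v : EuclideanSpace ℝ (Fin d)) (i : Fin k) :
    quantizationDeriv Y x (Pi.single i v) =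
      (voronoiCell Y i).indicator (fun x => inner ℝ v ((-2 : ℝ) • (x - Y i))) x := by
  rw [quantizationDeriv, sum_apply, Finset.sum_eq_single i]
  · by_cases hx : x ∈ voronoiCell Y i
    · simp [hx, inner_smul_right, inner_sub_right, real_inner_comm]
    · simp [hx]
  · intro j _ hj
    by_cases hx : x ∈ voronoiCell Y j
    · simp [hx, hj]
    · simp [hx]
  · simp

/-- The quantization noise power is differentiable at a configuration of distinct sites. -/
theorem hasFDerivAt_integral_iInf_norm_sub_sq {d k : ℕ} [NeZero k]
    {μ : Measure (EuclideanSpace ℝ (Fin d))} [IsFiniteMeasure μ]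
    (hac : μ ≪ volume) (hint : Integrable (fun x => ‖x‖ ^ 2) μ)
    {Y : Fin k → EuclideanSpace ℝ (Fin d)} (hY : Function.Injective Y) :
    Integrable (quantizationDeriv Y) μ ∧ HasFDerivAt
      (fun Z : Fin k → EuclideanSpace ℝ (Fin d) =>
        ∫ x, (⨅ i : Fin k, ‖x - Z i‖ ^ 2) ∂μ) (∫ x, quantizationDeriv Y x ∂μ) Y := by
  have hid : MemLp (fun x : EuclideanSpace ℝ (Fin d) => x) 2 μ :=
    (memLp_two_iff_integrable_sq_norm aestronglyMeasurable_id).2 hint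
  have hmeas (Z : Fin k → EuclideanSpace ℝ (Fin d)) :
      AEStronglyMeasurable (fun x => ⨅ i : Fin k, ‖x - Z i‖ ^ 2) μ :=
    (Measurable.iInf fun i => by fun_prop).aestronglyMeasurable
  have hF : Integrable (fun x => ⨅ i : Fin k, ‖x - Y i‖ ^ 2) μ := by
    have hsub : Integrable (fun x => ‖x - Y 0‖ ^ 2) μ :=
      (hid.sub (memLp_const (Y 0))).integrable_norm_pow two_ne_zero
    refine hsub.mono' (hmeas Y) (.of_forall fun x => ?_)
    rw [Real.norm_of_nonneg (Real.iInf_nonneg fun i => by positivity)]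
    exact ciInf_le (Set.finite_range _).bddBelow 0
  have hbound : Integrable (fun x => 2 * (‖x‖ + ‖Y‖ + 1)) μ :=
    (((hid.integrable one_le_two).norm.add (integrable_const ‖Y‖)).add
      (integrable_const 1)).const_mul 2
  have hdiff : ∀ᵐ x ∂μ, HasFDerivAt (fun Z : Fin k → EuclideanSpace ℝ (Fin d) =>
      ⨅ i : Fin k, ‖x - Z i‖ ^ 2) (quantizationDeriv Y x) Y := by
    filter_upwards [ae_exists_mem_voronoiCell hac hY] with x ⟨i, hi⟩
    rw [quantizationDeriv_of_mem hi]
    exact hasFDerivAt_iInf_norm_sub_sq hi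
  exact hasFDerivAt_integral_of_dominated_loc_of_lip
    (F := fun (Z : Fin k → EuclideanSpace ℝ (Fin d)) x => ⨅ i : Fin k, ‖x - Z i‖ ^ 2)
    (Metric.ball_mem_nhds Y one_pos)
    (.of_forall hmeas) hF (stronglyMeasurable_quantizationDeriv Y).aestronglyMeasurable
    (.of_forall fun x => lipschitzOnWith_iInf_norm_sub_sq Y x) hbound hdiff

/-- A stationary point of the quantization noise power is a centroidal Voronoi
tessellation: each point with a Voronoi cell of positive mass is the centroid of
its Voronoi cell. -/
theorem stationary_quantization_is_centroidal
    (d k : ℕ) (μ : Measure (EuclideanSpace ℝ (Fin d))) [IsFiniteMeasure μ]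
    (hac : μ ≪ volume) (hint : Integrable (fun x => ‖x‖ ^ 2) μ)
    (Y : Fin k → EuclideanSpace ℝ (Fin d)) (hY : Function.Injective Y)
    (hstat : fderiv ℝ
      (fun Z : Fin k → EuclideanSpace ℝ (Fin d) =>
        ∫ x, (⨅ i : Fin k, ‖x - Z i‖ ^ 2) ∂μ) Y = 0)
    (i : Fin k) (hm : 0 < μ (voronoiCell Y i)) :
    Y i = ((μ (voronoiCell Y i)).toReal)⁻¹ • ∫ x in voronoiCell Y i, x ∂μ := by
  have : NeZero k := ⟨(Fin.pos i).ne'⟩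
  have hid : Integrable (fun x : EuclideanSpace ℝ (Fin d) => x) μ :=
    ((memLp_two_iff_integrable_sq_norm aestronglyMeasurable_id).2 hint).integrable one_le_two
  obtain ⟨hint', hderiv⟩ := hasFDerivAt_integral_iInf_norm_sub_sq hac hint hY
  rw [hderiv.fderiv] at hstat
  have hsub : Integrable (fun x => (-2 : ℝ) • (x - Y i)) (μ.restrict (voronoiCell Y i)) :=
    ((hid.sub (integrable_const (Y i))).smul (-2 : ℝ)).integrableOn
  have hzero : ∫ x in voronoiCell Y i, (-2 : ℝ) • (x - Y i) ∂μ = 0 := by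
    refine ext_inner_left ℝ fun v => ?_
    rw [← integral_inner hsub, inner_zero_right,
      ← integral_indicator (isOpen_voronoiCell Y i).measurableSet]
    simp_rw [← quantizationDeriv_single]
    rw [← ContinuousLinearMap.integral_apply hint', hstat, zero_apply]
  rw [integral_smul, smul_eq_zero_iff_right (by norm_num),
    integral_sub hid.integrableOn (integrable_const _), sub_eq_zero, setIntegral_const] at hzero
  rw [hzero, Measure.real, inv_smul_smul₀]
  exact (ENNReal.toReal_pos hm.ne' (measure_ne_top _ _)).ne'
end
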